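/- For every integer i ≥ 7 and every integer g with g > 5i + 76, the images of a₁·a₂′^(i−1) and a₂′^i in S(g) form a ℚ-basis of the weighted-degree-i component S(g)_i; in particular dim_ℚ S(g)_i = 2. -/

import Mathlib

open MvPolynomial

noncomputable section

/-- The polynomial ring `ℚ[a₁, a₂′, a₂, c₂]`. -/
abbrev P4 : Type := MvPolynomial (Fin 4) ℚ

/-- Weights: `a₁` and `a₂′` have weight 1; `a₂` and `c₂` have weight 2. -/
def wt : Fin 4 → ℕ := ![1, 1, 2, 2]

def a1 : P4 := X 0
def a2' : P4 := X 1
def a2 : P4 := X 2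
def c2 : P4 := X 3

/-- The relation `r₁`. -/
def r1 (g : ℤ) : P4 :=
  C (1064*(g:ℚ) + 3610) * a1^3 - C (1074 : ℚ) * (a1^2 * a2')
    - C (2148*(g:ℚ) + 7272) * (a1 * a2) + C (2160 : ℚ) * (a2 * a2')
    - C (1064*(g:ℚ)^3 + 10830*(g:ℚ)^2 + 36680*(g:ℚ) + 41360) * (a1 * c2)
    + C (1074*(g:ℚ)^2 + 7272*(g:ℚ) + 12288) * (a2' * c2)

/-- The relation `r₂`. -/
def r2 (g : ℤ) : P4 :=
  - C (6412*(g:ℚ) + 21255) * a1^3 + C (6207 : ℚ) * (a1^2 * a2')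
    + C (12414*(g:ℚ) + 40896) * (a1 * a2) - C (11880 : ℚ) * (a2 * a2')
    + C (6412*(g:ℚ)^3 + 63765*(g:ℚ)^2 + 211540*(g:ℚ) + 234480) * (a1 * c2)
    - C (6207*(g:ℚ)^2 + 40896*(g:ℚ) + 68184) * (a2' * c2)

/-- The relation `r₃`. -/
def r3 (g : ℤ) : P4 :=
  - C (22845*(g:ℚ) + 67763) * a1^4 + C (18141 : ℚ) * (a1^3 * a2')
    + C (54423*(g:ℚ) + 146550) * (a1^2 * a2) - C (35640 : ℚ) * (a1 * a2 * a2')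
    + C (45690*(g:ℚ)^3 + 406578*(g:ℚ)^2 + 1184220*(g:ℚ) + 1123060) * (a1^2 * c2)
    - C (54423*(g:ℚ)^2 + 293100*(g:ℚ) + 372648) * (a1 * a2' * c2)
    + C (17820*(g:ℚ) + 24840) * (a2'^2 * c2)
    - C (17820*(g:ℚ) + 24840) * (a2^2)
    - C (18141*(g:ℚ)^3 + 146550*(g:ℚ)^2 + 372648*(g:ℚ) + 283824) * (a2 * c2)
    - C (4569*(g:ℚ)^5 + 67763*(g:ℚ)^4 + 394740*(g:ℚ)^3 + 1123060*(g:ℚ)^2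
        + 1546176*(g:ℚ) + 810432) * (c2^2)

/-- The relation `r₄`. -/
def r4 (g : ℤ) : P4 :=
  C (133 : ℚ) * a1^4 - C (537 : ℚ) * (a1^2 * a2)
    - C (798*(g:ℚ)^2 + 5415*(g:ℚ) + 9170) * (a1^2 * c2)
    + C (1074*(g:ℚ) + 3636) * (a1 * a2' * c2)
    - C (540 : ℚ) * (a2'^2 * c2) + C (540 : ℚ) * (a2^2)
    + C (537*(g:ℚ)^2 + 3636*(g:ℚ) + 6144) * (a2 * c2)
    + C (133*(g:ℚ)^4 + 1805*(g:ℚ)^3 + 9170*(g:ℚ)^2 + 20680*(g:ℚ) + 17472) * (c2^2)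

/-- The relation `r₅`. -/
def r5 (g : ℤ) : P4 :=
  - C (18545*(g:ℚ) + 68407) * a1^4 + C (15261 : ℚ) * (a1^3 * a2')
    + C (45783*(g:ℚ) + 175866) * (a1^2 * a2) - C (31320 : ℚ) * (a1 * a2 * a2')
    + C (37090*(g:ℚ)^3 + 410442*(g:ℚ)^2 + 1499460*(g:ℚ) + 1811300) * (a1^2 * c2)
    - C (45783*(g:ℚ)^2 + 351732*(g:ℚ) + 662976) * (a1 * a2' * c2)
    + C (15660*(g:ℚ) + 72360) * (a2'^2 * c2)
    - C (15660*(g:ℚ) + 72360) * (a2^2)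
    - C (15261*(g:ℚ)^3 + 175866*(g:ℚ)^2 + 662976*(g:ℚ) + 822096) * (a2 * c2)
    - C (3709*(g:ℚ)^5 + 68407*(g:ℚ)^4 + 499820*(g:ℚ)^3 + 1811300*(g:ℚ)^2
        + 3260256*(g:ℚ) + 2334528) * (c2^2)

/-- The ideal `J(g) = (r₁, r₂, r₃, r₄, r₅)`. -/
def Jg (g : ℤ) : Ideal P4 := Ideal.span {r1 g, r2 g, r3 g, r4 g, r5 g}

/-- The quotient map `P → S(g) = P/J(g)`, as a `ℚ`-linear map. -/
def Smk (g : ℤ) : P4 →ₗ[ℚ] P4 ⧸ Jg g := (Ideal.Quotient.mkₐ ℚ (Jg g)).toLinearMap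

/-- `S(g)_i`: the image in `S(g)` of the weighted-degree-`i` homogeneous polynomials. -/
def SComp (g : ℤ) (i : ℕ) : Submodule ℚ (P4 ⧸ Jg g) :=
  (weightedHomogeneousSubmodule ℚ wt i).map (Smk g)

section Algebra

variable {R : Type*} [CommRing R]

/-- The shape of the relations among `x, y` of weight `1` and `e, f` of weight `2` that
`r₁, …, r₅` take after the linear change of coordinates in `normalRelations_of_relations`. -/
structure NormalRelations (G x y e f : R) : Prop where
  ye : 24 * ((G + 1) * (G + 2)) * (y * e) =
    x * (2 * (2 * G ^ 2 + 11 * G + 10) * x ^ 2 - (3 * G + 10) * (x * y)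
      - (3 * G ^ 2 + 20 * G + 24) * e + 2 * (3 * G ^ 2 + 14 * G + 12) * f)
  yf : y * f = (2 * G + 3) * (x * e)
  ee : 24 * ((G + 1) * (G + 2)) ^ 2 * e ^ 2 =
    x ^ 2 * (-2 * (10 * G ^ 2 + 23 * G + 2) * x ^ 2 + (11 * G + 18) * (x * y)
      + 24 * ((G + 1) * (G + 2)) * y ^ 2 + (11 * G ^ 2 + 36 * G + 32) * e
      - 2 * (8 * G ^ 3 + 51 * G ^ 2 + 90 * G + 36) * f)
  ef : (G + 1) * (G + 2) * (e * f) = -(2 * G + 3) * x ^ 2 * (x * y + (2 * G + 3) * e)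
  ff : G * (G + 3) * (G + 4) * f ^ 2 =
    x ^ 2 * ((2 * G + 3) * (2 * G ^ 2 + 11 * G + 10) * x ^ 2
      + (8 * G ^ 3 + 46 * G ^ 2 + 81 * G + 50) * f)

theorem eq_of_isUnit_mul_sub {u a b : R} (hu : IsUnit u) (h : u * (a - b) = 0) : a = b :=
  sub_eq_zero.1 (hu.mul_right_eq_zero.1 h)

theorem span_pair_mul_annihilator_le {x y : R} {s t : Set R}
    (h : ∀ w, (∀ z ∈ t, w * z = 0) → ∀ z ∈ s, w * (x * z) = 0 ∧ w * (y * z) = 0) :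
    Ideal.span {x, y} * (Ideal.span t).annihilator ≤ (Ideal.span s).annihilator := by
  refine Ideal.mul_le.2 fun v hv w hw ↦ ?_
  obtain ⟨p, q, rfl⟩ := Ideal.mem_span_pair.1 hv
  refine (Submodule.mem_annihilator_span _ _).2 fun z ↦ ?_
  have hz := h w (fun z hz ↦ (Submodule.mem_annihilator_span _ _).1 hw ⟨z, hz⟩) z z.2
  rw [smul_eq_mul]
  linear_combination p * hz.1 + q * hz.2

theorem NormalRelations.sq_mul_y_cube {G x y e f : R}
    (h : NormalRelations G x y e f) :
    576 * ((G + 1) * (G + 2))^2 * (x^2 * y^3) =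
      -2 * (6*G^5 + 63*G^4 + 235*G^3 + 490*G^2 + 700*G + 472) * x^5
      - ((G + 1) * (G + 2)) * (288*G^3 + 1287*G^2 + 2004*G + 1588) * (x^4 * y)
      - 24 * ((G + 1) * (G + 2)) * (3*G^2 + 31*G + 42) * (x^3 * y^2)
      + ((G + 1) * (G + 2)) * (288*G^4 + 2457*G^3 + 6666*G^2 + 6224*G + 1200) * (x^3 * e)
      + 2 * (15*G^5 + 181*G^4 + 810*G^3 + 1608*G^2 + 1288*G + 240) * (x^3 * f) := by
  linear_combination (-24*(G + 2)*(G + 1)) * y * h.ee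
    + (24*(G + 2)*(G + 2)*(G + 1)*(G + 1)) * e * h.ye - (3*G^2 + 20*G + 24) * x * h.ee
    + (48*(G + 2)*(G + 1)*(3*G^2 + 14*G + 12)) * x * h.ef
    - (3*G^3 + 30*G^2 + 72*G + 52) * x^2 * h.ye
    + (48*(G + 2)*(G + 1)*(8*G^3 + 51*G^2 + 90*G + 36)) * x^2 * h.yf

variable [Algebra ℚ R]

theorem isUnit_of_algebraMap_eq {u : R} (q : ℚ) (hq : q ≠ 0) (h : algebraMap ℚ R q = u) :
    IsUnit u :=
  h ▸ (IsUnit.mk0 q hq).map (algebraMap ℚ R)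

variable {g : ℚ} {G : R}

theorem normalRelations_of_relations (hg : 0 < g) (hG : algebraMap ℚ R g = G) {x y a c : R}
    (h1 : (1064*G + 3610) * x^3 - 1074 * (x^2 * y)
      - (2148*G + 7272) * (x * a) + 2160 * (a * y)
      - (1064*G^3 + 10830*G^2 + 36680*G + 41360) * (x * c)
      + (1074*G^2 + 7272*G + 12288) * (y * c) = 0)
    (h2 : -(6412*G + 21255) * x^3 + 6207 * (x^2 * y)
      + (12414*G + 40896) * (x * a) - 11880 * (a * y)
      + (6412*G^3 + 63765*G^2 + 211540*G + 234480) * (x * c)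
      - (6207*G^2 + 40896*G + 68184) * (y * c) = 0)
    (h3 : -(22845*G + 67763) * x^4 + 18141 * (x^3 * y)
      + (54423*G + 146550) * (x^2 * a) - 35640 * (x * a * y)
      + (45690*G^3 + 406578*G^2 + 1184220*G + 1123060) * (x^2 * c)
      - (54423*G^2 + 293100*G + 372648) * (x * y * c)
      + (17820*G + 24840) * (y^2 * c)
      - (17820*G + 24840) * (a^2)
      - (18141*G^3 + 146550*G^2 + 372648*G + 283824) * (a * c)
      - (4569*G^5 + 67763*G^4 + 394740*G^3 + 1123060*G^2
          + 1546176*G + 810432) * (c^2) = 0)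
    (h4 : 133 * x^4 - 537 * (x^2 * a)
      - (798*G^2 + 5415*G + 9170) * (x^2 * c)
      + (1074*G + 3636) * (x * y * c)
      - 540 * (y^2 * c) + 540 * (a^2)
      + (537*G^2 + 3636*G + 6144) * (a * c)
      + (133*G^4 + 1805*G^3 + 9170*G^2 + 20680*G + 17472) * (c^2) = 0)
    (h5 : -(18545*G + 68407) * x^4 + 15261 * (x^3 * y)
      + (45783*G + 175866) * (x^2 * a) - 31320 * (x * a * y)
      + (37090*G^3 + 410442*G^2 + 1499460*G + 1811300) * (x^2 * c)
      - (45783*G^2 + 351732*G + 662976) * (x * y * c)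
      + (15660*G + 72360) * (y^2 * c)
      - (15660*G + 72360) * (a^2)
      - (15261*G^3 + 175866*G^2 + 662976*G + 822096) * (a * c)
      - (3709*G^5 + 68407*G^4 + 499820*G^3 + 1811300*G^2
          + 3260256*G + 2334528) * (c^2) = 0) :
    NormalRelations G x (15 * y - 7 * (2 * G + 7) * x)
      (15 * a - 7 * x ^ 2 + 7 * (G + 3) * (G + 4) * c) ((G + 1) * (G + 2) * c - x ^ 2) := by
  have u1 : IsUnit (40 : R) := isUnit_of_algebraMap_eq 40 (by norm_num) (map_ofNat _ _)
  have u2 : IsUnit (100 * (25 * G + 46)) :=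
    isUnit_of_algebraMap_eq (100 * (25 * g + 46)) (by positivity) (by simp only [map_mul, map_add, map_ofNat, hG])
  have ye := eq_of_isUnit_mul_sub
    (a := 24 * ((G + 1) * (G + 2)) * ((15 * y - 7 * (2 * G + 7) * x) *
      (15 * a - 7 * x ^ 2 + 7 * (G + 3) * (G + 4) * c)))
    (b := x * (2 * (2 * G ^ 2 + 11 * G + 10) * x ^ 2
      - (3 * G + 10) * (x * (15 * y - 7 * (2 * G + 7) * x))
      - (3 * G ^ 2 + 20 * G + 24) * (15 * a - 7 * x ^ 2 + 7 * (G + 3) * (G + 4) * c)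
      + 2 * (3 * G ^ 2 + 14 * G + 12) * ((G + 1) * (G + 2) * c - x ^ 2))) u1 (by
    linear_combination (221*G^2 + 696*G + 552) * h1 + (2*(11*G^2 + 36*G + 32)) * h2)
  have yf := eq_of_isUnit_mul_sub
    (a := (15 * y - 7 * (2 * G + 7) * x) * ((G + 1) * (G + 2) * c - x ^ 2))
    (b := (2 * G + 3) * (x * (15 * a - 7 * x ^ 2 + 7 * (G + 3) * (G + 4) * c))) u1 (by
    linear_combination (-11) * h1 - 2 * h2)
  refine ⟨ye, yf, eq_of_isUnit_mul_sub u2 ?_, eq_of_isUnit_mul_sub u2 ?_,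
    eq_of_isUnit_mul_sub u2 ?_⟩
  · linear_combination 2 * ((5*(G + 2)*(G + 1)*(33*G^2 + 56*G - 4)) * h3
      - (5*(G + 2)*(G + 1)*(2791*G^3 + 36924*G^2 + 106076*G + 90144)) * h4
      - (50*(G + 2)*(G + 1)*(22*G^2 + 79*G + 74)) * h5
      - (2791*G^2 + 12712*G + 14692) * ye * x
      - (30701*G^4 + 242158*G^3 + 699856*G^2 + 890096*G + 427744) * yf * x
      + (1200*(G + 2)*(G + 1)*(25*G + 46)) * yf * (15 * y - 7 * (2 * G + 7) * x))
  · linear_combination (-15*(G + 2)*(G + 1)) * h3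
      + (5*(G + 2)*(G + 1)*(481*G + 2542)) * h4 + (100*(G + 2)*(G + 1)) * h5
      + 481 * ye * x - (2209*G^2 + 6884*G + 3408) * yf * x
  · linear_combination (10*(G + 2)*(G + 1)*(13*G + 25)) * h3
      + (5*(G + 2)*(G + 1)*(1873*G^2 + 8986*G + 9000)) * h4
      + (25*(G + 2)*(G + 1)*(7*G + 10)) * h5 + (1873*G + 3100) * ye * x
      + (20603*G^3 + 103328*G^2 + 176936*G + 102800) * yf * x

namespace NormalRelations

variable {x y e f : R}

theorem cube_mul_e (h : NormalRelations G x y e f) (hg : 0 < g) (hG : algebraMap ℚ R g = G) :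
    (3*G^4 + 20*G^3 + 44*G^2 + 38*G + 10) * (x^3 * e) = -(G^3 + 6*G^2 + 8*G + 2) * (x^4 * y) := by
  have hu : IsUnit (2 * (2*G + 5) * (2*G + 3)) :=
    isUnit_of_algebraMap_eq (2 * (2*g + 5) * (2*g + 3)) (by positivity) (by simp only [map_mul, map_add, map_ofNat, hG])
  refine eq_of_isUnit_mul_sub hu ?_
  linear_combination (-(G + 2)*(G + 1)) * y * h.ff
    + ((G + 4)*(G + 3)*(G + 2)*(G + 1)*G) * f * h.yf
    + ((G + 4)*(G + 3)*G*(2*G + 3)) * x * h.ef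
    - ((G + 2)*(G + 1)*(8*G^3 + 46*G^2 + 81*G + 50)) * x^2 * h.yf

theorem cube_mul_y_sq (h : NormalRelations G x y e f) (hg : 0 < g)
    (hG : algebraMap ℚ R g = G) :
    24 * ((G + 1) * (G + 2)) * (x^3 * y^2) =
      -2 * (2*G^3 + 9*G^2 + 15*G + 14) * x^5 + 3 * ((G + 1) * (G + 2)) * (x^4 * y)
      + (3*G + 10) * ((G + 1) * (G + 2)) * (x^3 * e) + 2 * G * (G + 3) * (G + 4) * (x^3 * f) := by
  have hu : IsUnit (2 * (2*G + 3)) :=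
    isUnit_of_algebraMap_eq (2 * (2*g + 3)) (by positivity) (by simp only [map_mul, map_add, map_ofNat, hG])
  refine eq_of_isUnit_mul_sub hu ?_
  linear_combination (24*(G + 2)*(G + 1)) * y * h.ef
    - (24*(G + 2)*(G + 2)*(G + 1)*(G + 1)) * e * h.yf
    - (2*G + 3) * x * h.ee - ((2*G + 3)*(2*G + 3)) * x^2 * h.ye

theorem cube_mul_f (h : NormalRelations G x y e f) (hg : 0 < g) (hG : algebraMap ℚ R g = G) :
    5 * (G^4 + 8*G^3 + 20*G^2 + 16*G + 4) * (x^3 * f) =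
      -(2*G^4 + 19*G^3 + 54*G^2 + 44*G + 12) * x^5 := by
  have hu : IsUnit (4 * (G + 2) * (2*G + 5) * (2*G + 3)) :=
    isUnit_of_algebraMap_eq (4 * (g + 2) * (2*g + 5) * (2*g + 3)) (by positivity) (by simp only [map_mul, map_add, map_ofNat, hG])
  refine eq_of_isUnit_mul_sub hu ?_
  linear_combination (24*(G + 4)*(G + 3)*(G + 2)*(G + 1)*G) * y * h.ef
    - ((G + 4)*(G + 3)*(G + 2)*(G + 1)*G) * f * h.ye
    + ((G + 4)*(G + 3)*G*(3*G^2 + 20*G + 24)) * x * h.ef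
    - (2*(G + 2)*(G + 1)*(3*G^2 + 14*G + 12)) * x * h.ff
    - ((G + 4)*(G + 3)*G*(2*G + 3)*(2*G + 3)) * x^2 * h.ye
    + ((G + 4)*(G + 3)*(G + 2)*(G + 1)*G*(3*G + 10)) * x^2 * h.yf
    - ((G + 4)*(G + 3)*G*(2*G + 3)) * h.cube_mul_y_sq hg hG

theorem pow_five_mul_y (h : NormalRelations G x y e f) (hg : 0 < g)
    (hG : algebraMap ℚ R g = G) : x^5 * y = 0 := by
  have hu : IsUnit (2*(G + 4)*(G + 3)*(G + 3)*(G + 2)*(G + 1)*(G + 1)*G*(2*G + 1)) :=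
    isUnit_of_algebraMap_eq (2*(g + 4)*(g + 3)*(g + 3)*(g + 2)*(g + 1)*(g + 1)*g*(2*g + 1))
      (by positivity) (by simp only [map_mul, map_add, map_one, map_ofNat, hG])
  refine hu.mul_right_eq_zero.1 ?_
  linear_combination (-(3*G^4 + 20*G^3 + 44*G^2 + 38*G + 10)) * y * h.cube_mul_f hg hG
    + (5*(2*G + 3)*(G^4 + 8*G^3 + 20*G^2 + 16*G + 4)) * x * h.cube_mul_e hg hG
    + (5*(3*G^8 + 44*G^7 + 264*G^6 + 838*G^5 + 1526*G^4 + 1624*G^3 + 984*G^2 + 312*G + 40))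
      * x^3 * h.yf

theorem pow_seven (h : NormalRelations G x y e f) (hg : 0 < g)
    (hG : algebraMap ℚ R g = G) : x^7 = 0 := by
  have hu : IsUnit (4*(G + 2)*(G + 1)*(2*G + 7)*(9*G^8 + 120*G^7 + 664*G^6 + 1988*G^5
      + 3516*G^4 + 3744*G^3 + 2324*G^2 + 760*G + 100)) :=
    isUnit_of_algebraMap_eq (4*(g + 2)*(g + 1)*(2*g + 7)*(9*g^8 + 120*g^7 + 664*g^6 + 1988*g^5
      + 3516*g^4 + 3744*g^3 + 2324*g^2 + 760*g + 100)) (by positivity) (by simp only [map_mul, map_add, map_pow, map_one, map_ofNat, hG])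
  refine hu.mul_right_eq_zero.1 ?_
  linear_combination
    (5*(3*G^8 + 44*G^7 + 264*G^6 + 838*G^5 + 1526*G^4 + 1624*G^3 + 984*G^2 + 312*G + 40))
      * x^2 * h.cube_mul_y_sq hg hG
    + (5*(G + 2)*(G + 1)*(3*G + 10)*(G^4 + 8*G^3 + 20*G^2 + 16*G + 4))
      * x^2 * h.cube_mul_e hg hG
    + (2*(G + 4)*(G + 3)*G*(3*G^4 + 20*G^3 + 44*G^2 + 38*G + 10)) * x^2 * h.cube_mul_f hg hG
    + (10*(G + 2)*(G + 1)*(3*G^8 + 40*G^7 + 212*G^6 + 574*G^5 + 865*G^4 + 768*G^3 + 420*G^2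
      + 136*G + 20)) * x * h.pow_five_mul_y hg hG
    - (120*(G + 2)*(G + 1)*(3*G^8 + 44*G^7 + 264*G^6 + 838*G^5 + 1526*G^4 + 1624*G^3 + 984*G^2
      + 312*G + 40)) * y * h.pow_five_mul_y hg hG

theorem isUnit_coeff (hg : 0 < g) (hG : algebraMap ℚ R g = G) :
    IsUnit (24 * ((G + 1) * (G + 2))) :=
  isUnit_of_algebraMap_eq (24 * ((g + 1) * (g + 2))) (by positivity)
    (by simp only [map_mul, map_add, map_one, map_ofNat, hG])

theorem mul_y_mul_e_eq_zero (h : NormalRelations G x y e f) (hg : 0 < g)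
    (hG : algebraMap ℚ R g = G) {w : R} (h1 : w * x^3 = 0) (h2 : w * (x^2 * y) = 0)
    (h3 : w * (x * e) = 0) (h4 : w * (x * f) = 0) : w * (y * e) = 0 := by
  refine (isUnit_coeff hg hG).mul_right_eq_zero.1 ?_
  linear_combination w * h.ye + 2 * (2 * G ^ 2 + 11 * G + 10) * h1 - (3 * G + 10) * h2
    - (3 * G ^ 2 + 20 * G + 24) * h3 + 2 * (3 * G ^ 2 + 14 * G + 12) * h4

theorem mul_cube_mul_e_eq_zero (h : NormalRelations G x y e f) (hg : 0 < g)
    (hG : algebraMap ℚ R g = G) {w : R} (hw : w * (x^4 * y) = 0) : w * (x^3 * e) = 0 := by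
  have hu : IsUnit (3*G^4 + 20*G^3 + 44*G^2 + 38*G + 10) :=
    isUnit_of_algebraMap_eq (3*g^4 + 20*g^3 + 44*g^2 + 38*g + 10) (by positivity)
      (by simp only [map_mul, map_add, map_pow, map_ofNat, hG])
  refine hu.mul_right_eq_zero.1 ?_
  linear_combination w * h.cube_mul_e hg hG - (G^3 + 6*G^2 + 8*G + 2) * hw

theorem mul_cube_mul_f_eq_zero (h : NormalRelations G x y e f) (hg : 0 < g)
    (hG : algebraMap ℚ R g = G) {w : R} (hw : w * x^5 = 0) : w * (x^3 * f) = 0 := by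
  have hu : IsUnit (5 * (G^4 + 8*G^3 + 20*G^2 + 16*G + 4)) :=
    isUnit_of_algebraMap_eq (5 * (g^4 + 8*g^3 + 20*g^2 + 16*g + 4)) (by positivity)
      (by simp only [map_mul, map_add, map_pow, map_ofNat, hG])
  refine hu.mul_right_eq_zero.1 ?_
  linear_combination w * h.cube_mul_f hg hG - (2*G^4 + 19*G^3 + 54*G^2 + 44*G + 12) * hw

theorem mul_cube_mul_y_sq_eq_zero (h : NormalRelations G x y e f) (hg : 0 < g)
    (hG : algebraMap ℚ R g = G) {w : R} (h5 : w * x^5 = 0) (h4 : w * (x^4 * y) = 0) :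
    w * (x^3 * y^2) = 0 := by
  refine (isUnit_coeff hg hG).mul_right_eq_zero.1 ?_
  linear_combination w * h.cube_mul_y_sq hg hG - 2 * (2*G^3 + 9*G^2 + 15*G + 14) * h5
    + 3 * ((G + 1) * (G + 2)) * h4
    + (3*G + 10) * ((G + 1) * (G + 2)) * h.mul_cube_mul_e_eq_zero hg hG h4
    + 2 * G * (G + 3) * (G + 4) * h.mul_cube_mul_f_eq_zero hg hG h5

theorem mul_sq_mul_y_cube_eq_zero (h : NormalRelations G x y e f) (hg : 0 < g)
    (hG : algebraMap ℚ R g = G) {w : R} (h5 : w * x^5 = 0) (h4 : w * (x^4 * y) = 0) :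
    w * (x^2 * y^3) = 0 := by
  have hu : IsUnit (576 * ((G + 1) * (G + 2))^2) :=
    isUnit_of_algebraMap_eq (576 * ((g + 1) * (g + 2))^2) (by positivity)
      (by simp only [map_mul, map_add, map_pow, map_one, map_ofNat, hG])
  refine hu.mul_right_eq_zero.1 ?_
  linear_combination w * h.sq_mul_y_cube
    - 2 * (6*G^5 + 63*G^4 + 235*G^3 + 490*G^2 + 700*G + 472) * h5
    - ((G + 1) * (G + 2)) * (288*G^3 + 1287*G^2 + 2004*G + 1588) * h4
    - 24 * ((G + 1) * (G + 2)) * (3*G^2 + 31*G + 42) * h.mul_cube_mul_y_sq_eq_zero hg hG h5 h4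
    + ((G + 1) * (G + 2)) * (288*G^4 + 2457*G^3 + 6666*G^2 + 6224*G + 1200)
      * h.mul_cube_mul_e_eq_zero hg hG h4
    + 2 * (15*G^5 + 181*G^4 + 810*G^3 + 1608*G^2 + 1288*G + 240)
      * h.mul_cube_mul_f_eq_zero hg hG h5

theorem span_pair_pow_five_mul_span (h : NormalRelations G x y e f) (hg : 0 < g)
    (hG : algebraMap ℚ R g = G) :
    Ideal.span {x, y} ^ 5 * Ideal.span {x^2, e, f} = ⊥ := by
  have d0 : Ideal.span {x, y} * ⊤ ≤ (Ideal.span {x^6}).annihilator := by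
    have := span_pair_mul_annihilator_le (x := x) (y := y) (s := {x^6}) (t := ∅) (by
      rintro w - z rfl
      exact ⟨by linear_combination w * h.pow_seven hg hG,
        by linear_combination w * x * h.pow_five_mul_y hg hG⟩)
    rwa [Ideal.span_empty, Submodule.annihilator_bot] at this
  have d1 := span_pair_mul_annihilator_le (x := x) (y := y) (s := {x^5, x^4 * y}) (t := {x^6}) (by
    intro w hw
    simp only [Set.forall_mem_insert, Set.mem_singleton_iff, forall_eq] at hw ⊢
    have h5 := h.pow_five_mul_y hg hG
    exact ⟨⟨by linear_combination hw, by linear_combination w * h5⟩,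
      by linear_combination w * h5,
      by linear_combination h.mul_cube_mul_y_sq_eq_zero hg hG (w := w * x)
          (by linear_combination hw) (by linear_combination w * h5)⟩)
  have d2 := span_pair_mul_annihilator_le (x := x) (y := y)
    (s := {x^4, x^3 * y, x^2 * y^2, x^2 * e, x^2 * f}) (t := {x^5, x^4 * y}) (by
    intro w hw
    simp only [Set.forall_mem_insert, Set.mem_singleton_iff, forall_eq] at hw ⊢
    obtain ⟨h5, h4⟩ := hw
    have he := h.mul_cube_mul_e_eq_zero hg hG h4
    have hf := h.mul_cube_mul_f_eq_zero hg hG h5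
    have hy := h.mul_cube_mul_y_sq_eq_zero hg hG h5 h4
    exact ⟨⟨by linear_combination h5, by linear_combination h4⟩,
      ⟨by linear_combination h4, by linear_combination hy⟩,
      ⟨by linear_combination hy,
        by linear_combination h.mul_sq_mul_y_cube_eq_zero hg hG h5 h4⟩,
      ⟨by linear_combination he,
        by linear_combination h.mul_y_mul_e_eq_zero hg hG (w := w * x^2)
            (by linear_combination h5) (by linear_combination h4)
            (by linear_combination he) (by linear_combination hf)⟩,
      by linear_combination hf, by linear_combination w * x^2 * h.yf + (2 * G + 3) * he⟩)
  have d3 := span_pair_mul_annihilator_le (x := x) (y := y)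
    (s := {x^3, x^2 * y, x * e, x * f}) (t := {x^4, x^3 * y, x^2 * y^2, x^2 * e, x^2 * f}) (by
    intro w hw
    simp only [Set.forall_mem_insert, Set.mem_singleton_iff, forall_eq] at hw ⊢
    obtain ⟨h4, h3, h2, he, hf⟩ := hw
    exact ⟨⟨by linear_combination h4, by linear_combination h3⟩,
      ⟨by linear_combination h3, by linear_combination h2⟩,
      ⟨by linear_combination he,
        by linear_combination h.mul_y_mul_e_eq_zero hg hG (w := w * x)
            (by linear_combination h4) (by linear_combination h3)
            (by linear_combination he) (by linear_combination hf)⟩,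
      by linear_combination hf, by linear_combination w * x * h.yf + (2 * G + 3) * he⟩)
  have d4 := span_pair_mul_annihilator_le (x := x) (y := y)
    (s := {x^2, e, f}) (t := {x^3, x^2 * y, x * e, x * f}) (by
    intro w hw
    simp only [Set.forall_mem_insert, Set.mem_singleton_iff, forall_eq] at hw ⊢
    obtain ⟨h3, h2, he, hf⟩ := hw
    exact ⟨⟨by linear_combination h3, by linear_combination h2⟩,
      ⟨he, h.mul_y_mul_e_eq_zero hg hG h3 h2 he hf⟩,
      hf, by linear_combination w * h.yf + (2 * G + 3) * he⟩)
  have key : Ideal.span {x, y} ^ 5 ≤ (Ideal.span {x^2, e, f}).annihilator := by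
    have e5 : Ideal.span {x, y} ^ 5 = Ideal.span {x, y} * (Ideal.span {x, y} *
        (Ideal.span {x, y} * (Ideal.span {x, y} * (Ideal.span {x, y} * ⊤)))) := by
      rw [Ideal.mul_top]; ring
    rw [e5]
    refine (Ideal.mul_mono_right ?_).trans d4
    refine (Ideal.mul_mono_right ?_).trans d3
    refine (Ideal.mul_mono_right ?_).trans d2
    exact (Ideal.mul_mono_right d0).trans d1
  exact le_bot_iff.1 ((Ideal.mul_mono_left key).trans (Submodule.annihilator_mul _).le)

theorem span_mul_span_le (h : NormalRelations G x y e f) (hg : 0 < g)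
    (hG : algebraMap ℚ R g = G) :
    Ideal.span {x^2, e, f} * Ideal.span {x^2, e, f} ≤
      Ideal.span {x, y} ^ 2 * Ideal.span {x^2, e, f} := by
  have hx : x ∈ Ideal.span {x, y} := Ideal.subset_span (by simp)
  have hy : y ∈ Ideal.span {x, y} := Ideal.subset_span (by simp)
  have h2 : x^2 ∈ Ideal.span {x^2, e, f} := Ideal.subset_span (by simp)
  have he : e ∈ Ideal.span {x^2, e, f} := Ideal.subset_span (by simp)
  have hf : f ∈ Ideal.span {x^2, e, f} := Ideal.subset_span (by simp)
  set m := Ideal.span {x, y}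
  set L := Ideal.span {x^2, e, f} with hL
  have hxx : x^2 ∈ m^2 := Ideal.pow_mem_pow hx 2
  have hxy : x * y ∈ m^2 := sq m ▸ Ideal.mul_mem_mul hx hy
  have hyy : y^2 ∈ m^2 := Ideal.pow_mem_pow hy 2
  have mem {p q : R} (hp : p ∈ m^2) (hq : q ∈ L) : x^2 * (p + q) ∈ m^2 * L := by
    rw [mul_add, mul_comm _ p]
    exact add_mem (Ideal.mul_mem_mul hp h2) (Ideal.mul_mem_mul hxx hq)
  have u1 : IsUnit ((G + 1) * (G + 2)) :=
    isUnit_of_algebraMap_eq ((g + 1) * (g + 2)) (by positivity)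
      (by simp only [map_mul, map_add, map_one, map_ofNat, hG])
  have u2 : IsUnit (24 * ((G + 1) * (G + 2))^2) :=
    isUnit_of_algebraMap_eq (24 * ((g + 1) * (g + 2))^2) (by positivity)
      (by simp only [map_mul, map_add, map_pow, map_one, map_ofNat, hG])
  have u3 : IsUnit (G * (G + 3) * (G + 4)) :=
    isUnit_of_algebraMap_eq (g * (g + 3) * (g + 4)) (by positivity)
      (by simp only [map_mul, map_add, map_ofNat, hG])
  have mx {z : R} (hz : z ∈ L) : x^2 * z ∈ m^2 * L := Ideal.mul_mem_mul hxx hz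
  have mee : e^2 ∈ m^2 * L := by
    rw [← Ideal.unit_mul_mem_iff_mem _ u2, h.ee]
    convert mem (add_mem (add_mem
      (Ideal.mul_mem_left _ (-2 * (10 * G ^ 2 + 23 * G + 2)) hxx)
      (Ideal.mul_mem_left _ (11 * G + 18) hxy))
      (Ideal.mul_mem_left _ (24 * ((G + 1) * (G + 2))) hyy))
      (sub_mem (Ideal.mul_mem_left _ (11 * G ^ 2 + 36 * G + 32) he)
      (Ideal.mul_mem_left _ (2 * (8 * G ^ 3 + 51 * G ^ 2 + 90 * G + 36)) hf)) using 1
    ring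
  have mef : e * f ∈ m^2 * L := by
    rw [← Ideal.unit_mul_mem_iff_mem _ u1, h.ef, mul_assoc]
    exact Ideal.mul_mem_left _ _ (mem hxy (Ideal.mul_mem_left _ _ he))
  have mff : f^2 ∈ m^2 * L := by
    rw [← Ideal.unit_mul_mem_iff_mem _ u3, h.ff]
    exact mem (Ideal.mul_mem_left _ _ hxx) (Ideal.mul_mem_left _ _ hf)
  rw [hL, Ideal.span_mul_span', ← hL, Ideal.span_le, Set.mul_subset_iff]
  simp only [Set.forall_mem_insert, Set.mem_singleton_iff, forall_eq, SetLike.mem_coe]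
  exact ⟨⟨mx h2, mx he, mx hf⟩, ⟨mul_comm e _ ▸ mx he, sq e ▸ mee, mef⟩,
    mul_comm f _ ▸ mx hf, mul_comm f e ▸ mef, sq f ▸ mff⟩

theorem span_pair_pow_mul_span_pow (h : NormalRelations G x y e f) (hg : 0 < g)
    (hG : algebraMap ℚ R g = G) {k n : ℕ} (hkn : 5 ≤ k + 2 * n) :
    Ideal.span {x, y} ^ k * Ideal.span {x^2, e, f} ^ (n + 1) = ⊥ := by
  have hle : ∀ n, Ideal.span {x^2, e, f} ^ (n + 1) ≤
      Ideal.span {x, y} ^ (2 * n) * Ideal.span {x^2, e, f} := by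
    intro n
    induction n with
    | zero => simp
    | succ n ih =>
      calc Ideal.span {x^2, e, f} ^ (n + 1 + 1)
          = Ideal.span {x^2, e, f} ^ (n + 1) * Ideal.span {x^2, e, f} := pow_succ _ _
        _ ≤ Ideal.span {x, y} ^ (2 * n) * Ideal.span {x^2, e, f} * Ideal.span {x^2, e, f} :=
          Ideal.mul_mono_left ih
        _ = Ideal.span {x, y} ^ (2 * n) * (Ideal.span {x^2, e, f} * Ideal.span {x^2, e, f}) :=
          mul_assoc _ _ _
        _ ≤ Ideal.span {x, y} ^ (2 * n) *
            (Ideal.span {x, y} ^ 2 * Ideal.span {x^2, e, f}) :=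
          Ideal.mul_mono_right (h.span_mul_span_le hg hG)
        _ = Ideal.span {x, y} ^ (2 * (n + 1)) * Ideal.span {x^2, e, f} := by ring
  refine le_bot_iff.1 ?_
  calc Ideal.span {x, y} ^ k * Ideal.span {x^2, e, f} ^ (n + 1)
      ≤ Ideal.span {x, y} ^ k * (Ideal.span {x, y} ^ (2 * n) * Ideal.span {x^2, e, f}) :=
        Ideal.mul_mono_right (hle n)
    _ = Ideal.span {x, y} ^ (k + 2 * n) * Ideal.span {x^2, e, f} := by ring
    _ ≤ Ideal.span {x, y} ^ 5 * Ideal.span {x^2, e, f} :=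
        Ideal.mul_mono_left (Ideal.pow_le_pow_right hkn)
    _ = ⊥ := h.span_pair_pow_five_mul_span hg hG

theorem monomial_eq_zero {y a c : R} (h : NormalRelations G x (15 * y - 7 * (2 * G + 7) * x)
      (15 * a - 7 * x ^ 2 + 7 * (G + 3) * (G + 4) * c) ((G + 1) * (G + 2) * c - x ^ 2))
    (hg : 0 < g) (hG : algebraMap ℚ R g = G) {p q s t : ℕ} (hw : 7 ≤ p + q + 2 * (s + t))
    (hst : 1 ≤ s + t ∨ 2 ≤ p) : x^p * y^q * (a^s * c^t) = 0 := by
  have hpow {k n : ℕ} (hkn : 5 ≤ k + 2 * n) := h.span_pair_pow_mul_span_pow hg hG hkn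
  have hx : x ∈ Ideal.span {x, 15 * y - 7 * (2 * G + 7) * x} := Ideal.subset_span (by simp)
  have hY : 15 * y - 7 * (2 * G + 7) * x ∈ Ideal.span {x, 15 * y - 7 * (2 * G + 7) * x} :=
    Ideal.subset_span (by simp)
  set m := Ideal.span {x, 15 * y - 7 * (2 * G + 7) * x}
  set e := 15 * a - 7 * x ^ 2 + 7 * (G + 3) * (G + 4) * c with he_def
  set f := (G + 1) * (G + 2) * c - x ^ 2 with hf_def
  have h2 : x^2 ∈ Ideal.span {x^2, e, f} := Ideal.subset_span (by simp)
  have he : e ∈ Ideal.span {x^2, e, f} := Ideal.subset_span (by simp)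
  have hf : f ∈ Ideal.span {x^2, e, f} := Ideal.subset_span (by simp)
  set L := Ideal.span {x^2, e, f}
  have u15 : IsUnit (15 : R) := isUnit_of_algebraMap_eq 15 (by norm_num) (map_ofNat _ _)
  have u1 : IsUnit ((G + 1) * (G + 2)) :=
    isUnit_of_algebraMap_eq ((g + 1) * (g + 2)) (by positivity)
      (by simp only [map_mul, map_add, map_one, map_ofNat, hG])
  have hy : y ∈ m := by
    rw [← Ideal.unit_mul_mem_iff_mem _ u15]
    convert add_mem hY (Ideal.mul_mem_left _ (7 * (2 * G + 7)) hx) using 1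
    ring
  have hc : c ∈ L := by
    rw [← Ideal.unit_mul_mem_iff_mem _ u1]
    convert add_mem hf h2 using 1
    rw [hf_def]; ring
  have ha : a ∈ L := by
    rw [← Ideal.unit_mul_mem_iff_mem _ u15]
    convert sub_mem (add_mem he (Ideal.mul_mem_left _ 7 h2))
      (Ideal.mul_mem_left _ (7 * (G + 3) * (G + 4)) hc) using 1
    rw [he_def]; ring
  have hxy (p q : ℕ) : x^p * y^q ∈ m^(p + q) :=
    pow_add m p q ▸ Ideal.mul_mem_mul (Ideal.pow_mem_pow hx p) (Ideal.pow_mem_pow hy q)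
  have hac : a^s * c^t ∈ L^(s + t) :=
    pow_add L s t ▸ Ideal.mul_mem_mul (Ideal.pow_mem_pow ha s) (Ideal.pow_mem_pow hc t)
  rcases Nat.eq_zero_or_pos (s + t) with h0 | h0
  · obtain ⟨p, rfl⟩ := Nat.exists_eq_add_of_le' (hst.resolve_left (by omega))
    have : x^p * y^q * x^2 ∈ m^(p + q) * L^(0 + 1) :=
      Ideal.mul_mem_mul (hxy p q) (by simpa using h2)
    rw [hpow (by omega), Ideal.mem_bot] at this
    linear_combination a^s * c^t * this
  · obtain ⟨n, hn⟩ := Nat.exists_eq_add_of_le' h0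
    rw [hn] at hac
    have := Ideal.mul_mem_mul (hxy p q) hac
    rwa [hpow (by omega), Ideal.mem_bot] at this

end NormalRelations

end Algebra

section Quotient

variable {g : ℤ} {i : ℕ}

theorem normalRelations_quotient (hg : 0 < g) :
    NormalRelations (algebraMap ℚ (P4 ⧸ Jg g) g) (Ideal.Quotient.mk (Jg g) a1)
      (15 * Ideal.Quotient.mk (Jg g) a2' - 7 * (2 * algebraMap ℚ (P4 ⧸ Jg g) g + 7) *
        Ideal.Quotient.mk (Jg g) a1)
      (15 * Ideal.Quotient.mk (Jg g) a2 - 7 * Ideal.Quotient.mk (Jg g) a1 ^ 2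
        + 7 * (algebraMap ℚ (P4 ⧸ Jg g) g + 3) * (algebraMap ℚ (P4 ⧸ Jg g) g + 4) *
          Ideal.Quotient.mk (Jg g) c2)
      ((algebraMap ℚ (P4 ⧸ Jg g) g + 1) * (algebraMap ℚ (P4 ⧸ Jg g) g + 2) *
        Ideal.Quotient.mk (Jg g) c2 - Ideal.Quotient.mk (Jg g) a1 ^ 2) := by
  have hC (q : ℚ) : Ideal.Quotient.mk (Jg g) (C q) = algebraMap ℚ (P4 ⧸ Jg g) q := rfl
  have mem {r : P4} (hr : r ∈ ({r1 g, r2 g, r3 g, r4 g, r5 g} : Set P4)) :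
      Ideal.Quotient.mk (Jg g) r = 0 :=
    Ideal.Quotient.eq_zero_iff_mem.2 (Ideal.subset_span hr)
  have h1 := mem (r := r1 g) (by simp)
  have h2 := mem (r := r2 g) (by simp)
  have h3 := mem (r := r3 g) (by simp)
  have h4 := mem (r := r4 g) (by simp)
  have h5 := mem (r := r5 g) (by simp)
  simp only [r1, r2, r3, r4, r5, map_add, map_sub, map_neg, map_mul, map_pow, hC, map_ofNat]
    at h1 h2 h3 h4 h5
  exact normalRelations_of_relations (Int.cast_pos.2 hg) rfl h1 h2 h3 h4 h5

theorem Smk_monomial_eq_zero (hg : 0 < g) {p q s t : ℕ} (hw : 7 ≤ p + q + 2 * (s + t))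
    (hst : 1 ≤ s + t ∨ 2 ≤ p) : Smk g (a1^p * a2'^q * (a2^s * c2^t)) = 0 := by
  have := (normalRelations_quotient hg).monomial_eq_zero (Int.cast_pos.2 hg) rfl hw hst
  simp only [← map_pow, ← map_mul] at this
  exact this

theorem Smk_monomial_mem_span (hi : 7 ≤ i) (hg : 0 < g) {d : Fin 4 →₀ ℕ}
    (hd : Finsupp.weight wt d = i) (q : ℚ) : Smk g (monomial d q) ∈
      Submodule.span ℚ {Smk g (a1 * a2'^(i-1)), Smk g (a2'^i)} := by
  have hwt : d 0 + d 1 + 2 * (d 2 + d 3) = i := by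
    rw [← hd, Finsupp.weight_apply, Finsupp.sum_fintype _ _ (by simp)]
    simp [Fin.sum_univ_four, wt]
    ring
  have hmon : monomial d q = q • (a1^d 0 * a2'^d 1 * (a2^d 2 * c2^d 3)) := by
    rw [monomial_eq, Finsupp.prod_fintype _ _ (by simp), Fin.prod_univ_four, smul_eq_C_mul,
      a1, a2', a2, c2]
    ring
  rw [hmon, map_smul]
  refine Submodule.smul_mem _ _ ?_
  by_cases hst : 1 ≤ d 2 + d 3 ∨ 2 ≤ d 0
  · rw [Smk_monomial_eq_zero hg (by omega) hst]
    exact zero_mem _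
  · have h2 : d 2 = 0 := by omega
    have h3 : d 3 = 0 := by omega
    apply Submodule.subset_span
    rw [h2, h3]
    rcases (by omega : d 0 = 1 ∧ d 1 = i - 1 ∨ d 0 = 0 ∧ d 1 = i) with ⟨h0, h1⟩ | ⟨h0, h1⟩
    · simp [h0, h1]
    · simp [h0, h1]

theorem SComp_eq_span (hi : 7 ≤ i) (hg : 0 < g) :
    SComp g i = Submodule.span ℚ {Smk g (a1 * a2'^(i-1)), Smk g (a2'^i)} := by
  apply le_antisymm
  · rintro _ ⟨p, hp, rfl⟩
    rw [p.as_sum, map_sum]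
    exact sum_mem fun d hd ↦ Smk_monomial_mem_span hi hg (hp (mem_support_iff.1 hd)) _
  · have h1 : IsWeightedHomogeneous wt a1 1 := isWeightedHomogeneous_X ℚ wt 0
    have h2 (n : ℕ) : IsWeightedHomogeneous wt (a2'^n) n := by
      simpa [a2', wt] using (isWeightedHomogeneous_X ℚ wt 1).pow n
    rw [Submodule.span_le, Set.pair_subset_iff]
    refine ⟨Submodule.mem_map_of_mem ?_, Submodule.mem_map_of_mem (h2 i)⟩
    have := h1.mul (h2 (i - 1))
    rwa [show 1 + (i - 1) = i by omega] at this

/-- The algebra homomorphism `S(g) → ℚ[ε]` sending `a₁, a₂′, a₂, c₂` to `ε, 1, 0, 0`. -/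
def toDualNumber (g : ℤ) : (P4 ⧸ Jg g) →ₐ[ℚ] DualNumber ℚ :=
  Ideal.Quotient.liftₐ (Jg g) (aeval ![DualNumber.eps, 1, 0, 0]) fun p hp ↦ by
    refine (Ideal.span_le.2 ?_ : Jg g ≤ RingHom.ker (aeval ![DualNumber.eps, 1, 0, 0])) hp
    have hε : (DualNumber.eps : DualNumber ℚ) ^ 2 = 0 := by
      rw [sq, DualNumber.eps_mul_eps]
    have h3 : (DualNumber.eps : DualNumber ℚ) ^ 3 = 0 := by rw [pow_succ, hε, zero_mul]
    have h4 : (DualNumber.eps : DualNumber ℚ) ^ 4 = 0 := by rw [pow_succ, h3, zero_mul]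
    simp [Set.insert_subset_iff, r1, r2, r3, r4, r5, a1, a2', a2, c2, hε, h3, h4]

theorem linearIndependent_Smk (g : ℤ) (i : ℕ) :
    LinearIndependent ℚ ![Smk g (a1 * a2'^(i-1)), Smk g (a2'^i)] := by
  have h (p : P4) : toDualNumber g (Smk g p) = aeval ![DualNumber.eps, 1, 0, 0] p := rfl
  rw [LinearIndependent.pair_iff]
  intro s t hst
  have := congrArg (toDualNumber g) hst
  rw [map_add, map_smul, map_smul, h, h, map_zero] at this
  simp only [a1, a2', map_mul, map_pow, aeval_X] at this
  have h1 := congrArg TrivSqZeroExt.fst this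
  have h2 := congrArg TrivSqZeroExt.snd this
  simp at h1 h2
  exact ⟨h2, h1⟩

end Quotient

/-- For `i ≥ 7` and `g > 5i + 76`, the images of `a₁a₂′^(i−1)` and `a₂′^i` form a
`ℚ`-basis of `S(g)_i`; in particular `dim_ℚ S(g)_i = 2`. -/
theorem basis_SComp_high (i : ℕ) (hi : 7 ≤ i) (g : ℤ) (hg : g > 5 * (i : ℤ) + 76) :
    LinearIndependent ℚ ![Smk g (a1 * a2'^(i-1)), Smk g (a2'^i)] ∧
    SComp g i = Submodule.span ℚ {Smk g (a1 * a2'^(i-1)), Smk g (a2'^i)} ∧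
    Module.finrank ℚ (SComp g i) = 2 := by
  have hspan := SComp_eq_span hi (by omega : 0 < g)
  have hind := linearIndependent_Smk g i
  refine ⟨hind, hspan, ?_⟩
  have hrank := finrank_span_eq_card hind
  rwa [Matrix.range_cons, Matrix.range_cons, Matrix.range_empty, Set.union_empty,
    Set.singleton_union, Fintype.card_fin, ← hspan] at hrank
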